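/- arXiv:math/0412065 — 8 statements merged into one kernel-verified Lean document; each statement's English description precedes it below -/
import Mathlib

section
/- Let a, b, b', c ∈ ℂ and let D ⊆ ℂ × ℂ be an open set such that for every (v₁, v₂) ∈ D the numbers v₁, v₂, v₁−1, v₂−1 and v₁−v₂ all lie in ℂ ∖ (−∞, 0]. Define P₁(v₁,v₂) = (c−b')/v₁ + (a+b−c+1)/(v₁−1) + (b'−2b)/(v₁−v₂), P₂(v₁,v₂) = (c−b)/v₂ + (a+b'−c+1)/(v₂−1) + (b−2b')/(v₂−v₁), F₁(v₁,v₂) = b·v₂(v₂−1)/(v₁(v₁−1)(v₁−v₂)), F₂(v₁,v₂) = b'·v₁(v₁−1)/(v₂(v₂−1)(v₂−v₁)). Suppose z : D → ℂ has continuous partial derivatives up to order two and satisfies on D the system: ∂²z/∂v₁² + (1/3)P₁·∂z/∂v₁ − F₁·∂z/∂v₂ + (∂F₁/∂v₂ − (1/3)∂P₁/∂v₁ − (2/9)P₁² − (2/3)F₁P₂)·z = 0; ∂²z/∂v₁∂v₂ − (1/3)P₂·∂z/∂v₁ − (1/3)P₁·∂z/∂v₂ + ((1/3)∂P₂/∂v₁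 + (1/3)∂P₁/∂v₂ + (1/9)P₁P₂ − F₁F₂)·z = 0; ∂²z/∂v₂² + (1/3)P₂·∂z/∂v₂ − F₂·∂z/∂v₁ + (∂F₂/∂v₁ − (1/3)∂P₂/∂v₂ − (2/9)P₂² − (2/3)F₂P₁)·z = 0. Define w(v₁,v₂) = v₁^(−(c−b')/3) · v₂^(−(c−b)/3) · (v₁−1)^(−(a+b−c+1)/3) · (v₂−1)^(−(a+b'−c+1)/3) · (v₁−v₂)^(−(b+b')/3) · z(v₁,v₂), with all powers given by the principal complex power. Then on D the function w satisfies the Appell hypergeometric system: ∂²w/∂v₁² + ((c−b')/v₁ + (a+b−c+1)/(v₁−1) + b'/(v₁−v₂))·∂w/∂v₁ − (b·v₂(v₂−1)/(v₁(v₁−1)(v₁−v₂)))·∂w/∂v₂ + (ab/(v₁(v₁−1)))·w = 0; ∂²w/∂v₂² + ((c−b)/v₂ + (a+b'−c+1)/(v₂−1) + b/(v₂−v₁))·∂w/∂v₂ − (b'·v₁(v₁−1)/(v₂(v₂−1)(v₂−v₁)))·∂w/∂v₁ + (ab'/(v₂(v₂−1)))·w = 0; ∂²w/∂v₁∂v₂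 = (b'/(v₁−v₂))·∂w/∂v₁ − (b/(v₁−v₂))·∂w/∂v₂. -/
noncomputable section

/-- Complex partial derivative in the first variable of a function of two complex variables. -/
def pd₁ (f : ℂ → ℂ → ℂ) (x y : ℂ) : ℂ := deriv (fun t => f t y) x
/-- Complex partial derivative in the second variable of a function of two complex variables. -/
def pd₂ (f : ℂ → ℂ → ℂ) (x y : ℂ) : ℂ := deriv (fun t => f x t) y

theorem hasDerivAt_fst_of_differentiableAt {f : ℂ → ℂ → ℂ} {x y : ℂ}
    (hf : DifferentiableAt ℂ (fun p : ℂ × ℂ => f p.1 p.2) (x, y)) :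
    HasDerivAt (fun t => f t y) (pd₁ f x y) x := by
  have h : DifferentiableAt ℂ (fun t : ℂ => (t, y)) x := by fun_prop
  exact (DifferentiableAt.comp (g := fun p : ℂ × ℂ => f p.1 p.2) x hf h).hasDerivAt

theorem hasDerivAt_snd_of_differentiableAt {f : ℂ → ℂ → ℂ} {x y : ℂ}
    (hf : DifferentiableAt ℂ (fun p : ℂ × ℂ => f p.1 p.2) (x, y)) :
    HasDerivAt (fun t => f x t) (pd₂ f x y) y := by
  have h : DifferentiableAt ℂ (fun t : ℂ => (x, t)) y := by fun_prop
  exact (DifferentiableAt.comp (g := fun p : ℂ × ℂ => f p.1 p.2) y hf h).hasDerivAt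

theorem pd₁_eq_fderiv {f : ℂ → ℂ → ℂ} {p : ℂ × ℂ}
    (hf : DifferentiableAt ℂ (fun p : ℂ × ℂ => f p.1 p.2) p) :
    pd₁ f p.1 p.2 = fderiv ℂ (fun p : ℂ × ℂ => f p.1 p.2) p (1, 0) :=
  (HasFDerivAt.comp_hasDerivAt (l := fun p : ℂ × ℂ => f p.1 p.2) (f := fun t => (t, p.2))
    p.1 hf.hasFDerivAt ((hasDerivAt_id p.1).prodMk (hasDerivAt_const p.1 p.2))).deriv

theorem pd₂_eq_fderiv {f : ℂ → ℂ → ℂ} {p : ℂ × ℂ}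
    (hf : DifferentiableAt ℂ (fun p : ℂ × ℂ => f p.1 p.2) p) :
    pd₂ f p.1 p.2 = fderiv ℂ (fun p : ℂ × ℂ => f p.1 p.2) p (0, 1) :=
  (HasFDerivAt.comp_hasDerivAt (l := fun p : ℂ × ℂ => f p.1 p.2) (f := fun t => (p.1, t))
    p.2 hf.hasFDerivAt ((hasDerivAt_const p.2 p.1).prodMk (hasDerivAt_id p.2))).deriv

section OpenDomain

variable {D : Set (ℂ × ℂ)} {f g : ℂ → ℂ → ℂ}

theorem pd₁_congr (hD : IsOpen D) (h : ∀ p ∈ D, f p.1 p.2 = g p.1 p.2) :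
    ∀ p ∈ D, pd₁ f p.1 p.2 = pd₁ g p.1 p.2 := by
  intro p hp
  have hc : ContinuousAt (fun t : ℂ => (t, p.2)) p.1 := by fun_prop
  refine Filter.EventuallyEq.deriv_eq ?_
  filter_upwards [hc.preimage_mem_nhds (hD.mem_nhds hp)] with t ht using h (t, p.2) ht

theorem pd₂_congr (hD : IsOpen D) (h : ∀ p ∈ D, f p.1 p.2 = g p.1 p.2) :
    ∀ p ∈ D, pd₂ f p.1 p.2 = pd₂ g p.1 p.2 := by
  intro p hp
  have hc : ContinuousAt (fun t : ℂ => (p.1, t)) p.2 := by fun_prop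
  refine Filter.EventuallyEq.deriv_eq ?_
  filter_upwards [hc.preimage_mem_nhds (hD.mem_nhds hp)] with t ht using h (p.1, t) ht

theorem differentiableAt_pd₁ (hD : IsOpen D)
    (hf : ContDiffOn ℂ 2 (fun p : ℂ × ℂ => f p.1 p.2) D) {p : ℂ × ℂ} (hp : p ∈ D) :
    DifferentiableAt ℂ (fun p : ℂ × ℂ => pd₁ f p.1 p.2) p := by
  have h : DifferentiableAt ℂ (fderiv ℂ fun p : ℂ × ℂ => f p.1 p.2) p :=
    ((hf.contDiffAt (hD.mem_nhds hp)).fderiv_right (m := 1) (by norm_num)).differentiableAt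
      (by norm_num)
  refine (h.clm_apply (differentiableAt_const ((1, 0) : ℂ × ℂ))).congr_of_eventuallyEq ?_
  filter_upwards [hD.mem_nhds hp] with q hq
  exact pd₁_eq_fderiv ((hf.contDiffAt (hD.mem_nhds hq)).differentiableAt (by norm_num))

theorem differentiableAt_pd₂ (hD : IsOpen D)
    (hf : ContDiffOn ℂ 2 (fun p : ℂ × ℂ => f p.1 p.2) D) {p : ℂ × ℂ} (hp : p ∈ D) :
    DifferentiableAt ℂ (fun p : ℂ × ℂ => pd₂ f p.1 p.2) p := by
  have h : DifferentiableAt ℂ (fderiv ℂ fun p : ℂ × ℂ => f p.1 p.2) p :=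
    ((hf.contDiffAt (hD.mem_nhds hp)).fderiv_right (m := 1) (by norm_num)).differentiableAt
      (by norm_num)
  refine (h.clm_apply (differentiableAt_const ((0, 1) : ℂ × ℂ))).congr_of_eventuallyEq ?_
  filter_upwards [hD.mem_nhds hp] with q hq
  exact pd₂_eq_fderiv ((hf.contDiffAt (hD.mem_nhds hq)).differentiableAt (by norm_num))

/-- Partial derivatives up to order two of a product `M * z` in terms of the logarithmic
derivatives `A₁`, `A₂` of the factor `M`. -/
theorem pd_mul_of_hasDerivAt_log (hD : IsOpen D) {z M A₁ A₂ A₁₁ A₁₂ A₂₂ : ℂ → ℂ → ℂ}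
    (hz : ContDiffOn ℂ 2 (fun p : ℂ × ℂ => z p.1 p.2) D)
    (hM₁ : ∀ p ∈ D, HasDerivAt (fun t => M t p.2) (A₁ p.1 p.2 * M p.1 p.2) p.1)
    (hM₂ : ∀ p ∈ D, HasDerivAt (fun t => M p.1 t) (A₂ p.1 p.2 * M p.1 p.2) p.2)
    (hA₁₁ : ∀ p ∈ D, HasDerivAt (fun t => A₁ t p.2) (A₁₁ p.1 p.2) p.1)
    (hA₁₂ : ∀ p ∈ D, HasDerivAt (fun t => A₂ t p.2) (A₁₂ p.1 p.2) p.1)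
    (hA₂₂ : ∀ p ∈ D, HasDerivAt (fun t => A₂ p.1 t) (A₂₂ p.1 p.2) p.2) :
    ∀ p ∈ D,
      pd₁ (fun x y => M x y * z x y) p.1 p.2
        = M p.1 p.2 * (pd₁ z p.1 p.2 + A₁ p.1 p.2 * z p.1 p.2) ∧
      pd₂ (fun x y => M x y * z x y) p.1 p.2
        = M p.1 p.2 * (pd₂ z p.1 p.2 + A₂ p.1 p.2 * z p.1 p.2) ∧
      pd₁ (pd₁ fun x y => M x y * z x y) p.1 p.2
        = M p.1 p.2 * (pd₁ (pd₁ z) p.1 p.2 + 2 * A₁ p.1 p.2 * pd₁ z p.1 p.2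
          + (A₁₁ p.1 p.2 + A₁ p.1 p.2 ^ 2) * z p.1 p.2) ∧
      pd₂ (pd₂ fun x y => M x y * z x y) p.1 p.2
        = M p.1 p.2 * (pd₂ (pd₂ z) p.1 p.2 + 2 * A₂ p.1 p.2 * pd₂ z p.1 p.2
          + (A₂₂ p.1 p.2 + A₂ p.1 p.2 ^ 2) * z p.1 p.2) ∧
      pd₁ (pd₂ fun x y => M x y * z x y) p.1 p.2
        = M p.1 p.2 * (pd₁ (pd₂ z) p.1 p.2 + A₂ p.1 p.2 * pd₁ z p.1 p.2
          + A₁ p.1 p.2 * pd₂ z p.1 p.2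
          + (A₁₂ p.1 p.2 + A₁ p.1 p.2 * A₂ p.1 p.2) * z p.1 p.2) := by
  have hzd : ∀ p ∈ D, DifferentiableAt ℂ (fun p : ℂ × ℂ => z p.1 p.2) p := fun p hp =>
    (hz.contDiffAt (hD.mem_nhds hp)).differentiableAt (by norm_num)
  have hz₁ : ∀ p ∈ D, HasDerivAt (fun t => z t p.2) (pd₁ z p.1 p.2) p.1 := fun p hp =>
    hasDerivAt_fst_of_differentiableAt (hzd p hp)
  have hz₂ : ∀ p ∈ D, HasDerivAt (fun t => z p.1 t) (pd₂ z p.1 p.2) p.2 := fun p hp =>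
    hasDerivAt_snd_of_differentiableAt (hzd p hp)
  have hw₁ : ∀ p ∈ D, pd₁ (fun x y => M x y * z x y) p.1 p.2
      = M p.1 p.2 * (pd₁ z p.1 p.2 + A₁ p.1 p.2 * z p.1 p.2) := fun p hp =>
    ((hM₁ p hp).fun_mul (hz₁ p hp)).deriv.trans (by ring)
  have hw₂ : ∀ p ∈ D, pd₂ (fun x y => M x y * z x y) p.1 p.2
      = M p.1 p.2 * (pd₂ z p.1 p.2 + A₂ p.1 p.2 * z p.1 p.2) := fun p hp =>
    ((hM₂ p hp).fun_mul (hz₂ p hp)).deriv.trans (by ring)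
  intro p hp
  have hz₁₁ : HasDerivAt (fun t => pd₁ z t p.2) (pd₁ (pd₁ z) p.1 p.2) p.1 :=
    hasDerivAt_fst_of_differentiableAt (differentiableAt_pd₁ hD hz hp)
  have hz₁₂ : HasDerivAt (fun t => pd₂ z t p.2) (pd₁ (pd₂ z) p.1 p.2) p.1 :=
    hasDerivAt_fst_of_differentiableAt (differentiableAt_pd₂ hD hz hp)
  have hz₂₂ : HasDerivAt (fun t => pd₂ z p.1 t) (pd₂ (pd₂ z) p.1 p.2) p.2 :=
    hasDerivAt_snd_of_differentiableAt (differentiableAt_pd₂ hD hz hp)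
  refine ⟨hw₁ p hp, hw₂ p hp, ?_, ?_, ?_⟩
  · rw [pd₁_congr (g := fun x y => M x y * (pd₁ z x y + A₁ x y * z x y)) hD hw₁ p hp]
    exact ((hM₁ p hp).fun_mul
      (hz₁₁.fun_add ((hA₁₁ p hp).fun_mul (hz₁ p hp)))).deriv.trans (by ring)
  · rw [pd₂_congr (g := fun x y => M x y * (pd₂ z x y + A₂ x y * z x y)) hD hw₂ p hp]
    exact ((hM₂ p hp).fun_mul
      (hz₂₂.fun_add ((hA₂₂ p hp).fun_mul (hz₂ p hp)))).deriv.trans (by ring)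
  · rw [pd₁_congr (g := fun x y => M x y * (pd₂ z x y + A₂ x y * z x y)) hD hw₂ p hp]
    exact ((hM₁ p hp).fun_mul
      (hz₁₂.fun_add ((hA₁₂ p hp).fun_mul (hz₁ p hp)))).deriv.trans (by ring)

end OpenDomain

theorem HasDerivAt.cpow_const_eq_mul_self {f : ℂ → ℂ} {f' x : ℂ} (hf : HasDerivAt f f' x)
    (hx : f x ∈ Complex.slitPlane) (s : ℂ) :
    HasDerivAt (fun t => f t ^ s) (s * f' / f x * f x ^ s) x := by
  convert hf.cpow_const (c := s) hx using 1
  rw [Complex.cpow_sub _ _ (Complex.slitPlane_ne_zero hx), Complex.cpow_one]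
  ring

theorem hasDerivAt_const_div_sub_const {x m : ℂ} (k : ℂ) (h : x - m ≠ 0) :
    HasDerivAt (fun t => k / (t - m)) (-k / (x - m) ^ 2) x := by
  simpa using (hasDerivAt_const x k).fun_div ((hasDerivAt_id' x).sub_const m) h

theorem hasDerivAt_const_div_const_sub {x m : ℂ} (k : ℂ) (h : m - x ≠ 0) :
    HasDerivAt (fun t => k / (m - t)) (k / (m - x) ^ 2) x := by
  simpa using (hasDerivAt_const x k).fun_div ((hasDerivAt_id' x).const_sub m) h

/-- Derivative of a sum of simple fractions with poles at `0`, `1` and `m`. -/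
theorem hasDerivAt_fractions_sub_const {x m : ℂ} (k l n : ℂ) (h₀ : x ≠ 0) (h₁ : x - 1 ≠ 0)
    (h : x - m ≠ 0) :
    HasDerivAt (fun t => k / t + l / (t - 1) + n / (t - m))
      (-k / x ^ 2 + -l / (x - 1) ^ 2 + -n / (x - m) ^ 2) x := by
  have h0 := hasDerivAt_const_div_sub_const (m := 0) k (by simpa using h₀)
  simp only [sub_zero] at h0
  exact (h0.fun_add (hasDerivAt_const_div_sub_const l h₁)).fun_add
    (hasDerivAt_const_div_sub_const n h)

/-- Derivative in the remaining variable of a sum of simple fractions. -/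
theorem hasDerivAt_fractions_const_sub {x m : ℂ} (k n : ℂ) (h : m - x ≠ 0) :
    HasDerivAt (fun t => k + n / (m - t)) (n / (m - x) ^ 2) x :=
  (hasDerivAt_const_div_const_sub n h).const_add k

/-- Derivative of the coefficient of the transversal first-order term. -/
theorem hasDerivAt_transversal_coeff {x y : ℂ} (k : ℂ) (hx : x ≠ 0) (hx₁ : x - 1 ≠ 0)
    (h : x - y ≠ 0) :
    HasDerivAt (fun t => k * t * (t - 1) / (x * (x - 1) * (x - t)))
      (k * ((2 * y - 1) * (x - y) + y * (y - 1)) / (x * (x - 1) * (x - y) ^ 2)) y := by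
  have hn := ((hasDerivAt_id' y).const_mul k).fun_mul ((hasDerivAt_id' y).sub_const 1)
  have hd := ((hasDerivAt_id' y).const_sub x).const_mul (x * (x - 1))
  refine (hn.fun_div hd (mul_ne_zero (mul_ne_zero hx hx₁) h)).congr_deriv ?_
  field_simp
  ring

/-- Reciprocity law: a solution of the auxiliary linear system, multiplied by the indicated
product of principal complex powers, satisfies the Appell hypergeometric system. -/
theorem reciprocity_law (a b b' c : ℂ)
    (D : Set (ℂ × ℂ)) (hD : IsOpen D)
    (hslit : ∀ p ∈ D, p.1 ∈ Complex.slitPlane ∧ p.2 ∈ Complex.slitPlane ∧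
      p.1 - 1 ∈ Complex.slitPlane ∧ p.2 - 1 ∈ Complex.slitPlane ∧
      p.1 - p.2 ∈ Complex.slitPlane)
    (z : ℂ → ℂ → ℂ)
    (hz : ContDiffOn ℂ 2 (fun p : ℂ × ℂ => z p.1 p.2) D)
    (P₁ P₂ F₁ F₂ : ℂ → ℂ → ℂ)
    (hP₁ : P₁ = fun v₁ v₂ =>
      (c - b')/v₁ + (a + b - c + 1)/(v₁ - 1) + (b' - 2*b)/(v₁ - v₂))
    (hP₂ : P₂ = fun v₁ v₂ =>
      (c - b)/v₂ + (a + b' - c + 1)/(v₂ - 1) + (b - 2*b')/(v₂ - v₁))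
    (hF₁ : F₁ = fun v₁ v₂ => b * v₂ * (v₂ - 1) / (v₁ * (v₁ - 1) * (v₁ - v₂)))
    (hF₂ : F₂ = fun v₁ v₂ => b' * v₁ * (v₁ - 1) / (v₂ * (v₂ - 1) * (v₂ - v₁)))
    (heq1 : ∀ p ∈ D,
      pd₁ (pd₁ z) p.1 p.2 + (1/3) * P₁ p.1 p.2 * pd₁ z p.1 p.2
        - F₁ p.1 p.2 * pd₂ z p.1 p.2
        + (pd₂ F₁ p.1 p.2 - (1/3) * pd₁ P₁ p.1 p.2 - (2/9) * (P₁ p.1 p.2)^2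
            - (2/3) * F₁ p.1 p.2 * P₂ p.1 p.2) * z p.1 p.2 = 0)
    (heq2 : ∀ p ∈ D,
      pd₁ (pd₂ z) p.1 p.2 - (1/3) * P₂ p.1 p.2 * pd₁ z p.1 p.2
        - (1/3) * P₁ p.1 p.2 * pd₂ z p.1 p.2
        + ((1/3) * pd₁ P₂ p.1 p.2 + (1/3) * pd₂ P₁ p.1 p.2
            + (1/9) * P₁ p.1 p.2 * P₂ p.1 p.2 - F₁ p.1 p.2 * F₂ p.1 p.2) * z p.1 p.2 = 0)
    (heq3 : ∀ p ∈ D,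
      pd₂ (pd₂ z) p.1 p.2 + (1/3) * P₂ p.1 p.2 * pd₂ z p.1 p.2
        - F₂ p.1 p.2 * pd₁ z p.1 p.2
        + (pd₁ F₂ p.1 p.2 - (1/3) * pd₂ P₂ p.1 p.2 - (2/9) * (P₂ p.1 p.2)^2
            - (2/3) * F₂ p.1 p.2 * P₁ p.1 p.2) * z p.1 p.2 = 0)
    (w : ℂ → ℂ → ℂ)
    (hw : w = fun v₁ v₂ =>
      v₁ ^ (-(c - b')/3) * v₂ ^ (-(c - b)/3) * (v₁ - 1) ^ (-(a + b - c + 1)/3)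
        * (v₂ - 1) ^ (-(a + b' - c + 1)/3) * (v₁ - v₂) ^ (-(b + b')/3) * z v₁ v₂) :
    ∀ p ∈ D,
      (pd₁ (pd₁ w) p.1 p.2
        + ((c - b')/p.1 + (a + b - c + 1)/(p.1 - 1) + b'/(p.1 - p.2)) * pd₁ w p.1 p.2
        - (b * p.2 * (p.2 - 1) / (p.1 * (p.1 - 1) * (p.1 - p.2))) * pd₂ w p.1 p.2
        + (a*b / (p.1 * (p.1 - 1))) * w p.1 p.2 = 0) ∧
      (pd₂ (pd₂ w) p.1 p.2
        + ((c - b)/p.2 + (a + b' - c + 1)/(p.2 - 1) + b/(p.2 - p.1)) * pd₂ w p.1 p.2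
        - (b' * p.1 * (p.1 - 1) / (p.2 * (p.2 - 1) * (p.2 - p.1))) * pd₁ w p.1 p.2
        + (a*b' / (p.2 * (p.2 - 1))) * w p.1 p.2 = 0) ∧
      (pd₁ (pd₂ w) p.1 p.2
        = (b'/(p.1 - p.2)) * pd₁ w p.1 p.2 - (b/(p.1 - p.2)) * pd₂ w p.1 p.2) := by
  subst hw
  have key := pd_mul_of_hasDerivAt_log hD (z := z)
    (M := fun v₁ v₂ => v₁ ^ (-(c - b')/3) * v₂ ^ (-(c - b)/3) * (v₁ - 1) ^ (-(a + b - c + 1)/3)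
        * (v₂ - 1) ^ (-(a + b' - c + 1)/3) * (v₁ - v₂) ^ (-(b + b')/3))
    (A₁ := fun x y => (-(c - b')/3) / x + (-(a + b - c + 1)/3) / (x - 1)
        + (-(b + b')/3) / (x - y))
    (A₂ := fun x y => (-(c - b)/3) / y + (-(a + b' - c + 1)/3) / (y - 1)
        + (-(b + b')/3) / (y - x))
    (A₁₁ := fun x y => -(-(c - b')/3) / x ^ 2 + -(-(a + b - c + 1)/3) / (x - 1) ^ 2
        + -(-(b + b')/3) / (x - y) ^ 2)
    (A₁₂ := fun x y => (-(b + b')/3) / (y - x) ^ 2)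
    (A₂₂ := fun x y => -(-(c - b)/3) / y ^ 2 + -(-(a + b' - c + 1)/3) / (y - 1) ^ 2
        + -(-(b + b')/3) / (y - x) ^ 2)
    hz ?_ ?_ ?_ ?_ ?_
  · rintro ⟨x, y⟩ hp
    obtain ⟨hx, hy, hx₁, hy₁, hxy⟩ := hslit _ hp
    have hx0 := Complex.slitPlane_ne_zero hx
    have hy0 := Complex.slitPlane_ne_zero hy
    have hx10 := Complex.slitPlane_ne_zero hx₁
    have hy10 := Complex.slitPlane_ne_zero hy₁
    have hxy0 := Complex.slitPlane_ne_zero hxy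
    have hyx0 : y - x ≠ 0 := by rw [← neg_sub]; exact neg_ne_zero.2 hxy0
    have hyx : y - x = -(x - y) := (neg_sub x y).symm
    have e1 := heq1 _ hp
    have e2 := heq2 _ hp
    have e3 := heq3 _ hp
    obtain ⟨k1, k2, k11, k22, k12⟩ := key _ hp
    have dP₁₁ : pd₁ P₁ x y = -(c - b') / x ^ 2 + -(a + b - c + 1) / (x - 1) ^ 2
        + -(b' - 2 * b) / (x - y) ^ 2 := by
      rw [hP₁]; exact (hasDerivAt_fractions_sub_const _ _ _ hx0 hx10 hxy0).deriv
    have dP₁₂ : pd₂ P₁ x y = (b' - 2 * b) / (x - y) ^ 2 := by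
      rw [hP₁]; exact (hasDerivAt_fractions_const_sub _ _ hxy0).deriv
    have dP₂₁ : pd₁ P₂ x y = (b - 2 * b') / (y - x) ^ 2 := by
      rw [hP₂]; exact (hasDerivAt_fractions_const_sub _ _ hyx0).deriv
    have dP₂₂ : pd₂ P₂ x y = -(c - b) / y ^ 2 + -(a + b' - c + 1) / (y - 1) ^ 2
        + -(b - 2 * b') / (y - x) ^ 2 := by
      rw [hP₂]; exact (hasDerivAt_fractions_sub_const _ _ _ hy0 hy10 hyx0).deriv
    have dF₁ : pd₂ F₁ x y
        = b * ((2 * y - 1) * (x - y) + y * (y - 1)) / (x * (x - 1) * (x - y) ^ 2) := by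
      rw [hF₁]; exact (hasDerivAt_transversal_coeff b hx0 hx10 hxy0).deriv
    have dF₂ : pd₁ F₂ x y
        = b' * ((2 * x - 1) * (y - x) + x * (x - 1)) / (y * (y - 1) * (y - x) ^ 2) := by
      rw [hF₂]; exact (hasDerivAt_transversal_coeff b' hy0 hy10 hyx0).deriv
    simp only at e1 e2 e3 k1 k2 k11 k22 k12 hx0 hy0 hx10 hy10 hxy0 ⊢
    rw [dF₁, dP₁₁] at e1
    rw [dP₂₁, dP₁₂] at e2
    rw [dF₂, dP₂₂] at e3
    rw [k1, k2, k11, k22, k12]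
    clear dF₁ dF₂ dP₁₁ dP₁₂ dP₂₁ dP₂₂ k1 k2 k11 k22 k12 heq1 heq2 heq3 key
    simp only [hP₁, hP₂, hF₁, hF₂, hyx] at e1 e2 e3 ⊢
    generalize x ^ (-(c - b')/3) * y ^ (-(c - b)/3) * (x - 1) ^ (-(a + b - c + 1)/3)
        * (y - 1) ^ (-(a + b' - c + 1)/3) * (x - y) ^ (-(b + b')/3) = M
    generalize pd₁ (pd₁ z) x y = z₁₁ at *
    generalize pd₁ (pd₂ z) x y = z₁₂ at *
    generalize pd₂ (pd₂ z) x y = z₂₂ at *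
    generalize pd₁ z x y = z₁ at *
    generalize pd₂ z x y = z₂ at *
    generalize z x y = z₀ at *
    refine ⟨?_, ?_, ?_⟩
    · linear_combination (norm := (field_simp; ring)) M * e1
    · linear_combination (norm := (field_simp; ring)) M * e3
    · linear_combination (norm := (field_simp; ring)) M * e2
  · rintro ⟨x, y⟩ hp
    obtain ⟨hx, hy, hx₁, hy₁, hxy⟩ := hslit _ hp
    have h1 := (hasDerivAt_id' x).cpow_const_eq_mul_self hx (-(c - b')/3)
    have h2 := ((hasDerivAt_id' x).sub_const 1).cpow_const_eq_mul_self hx₁ (-(a + b - c + 1)/3)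
    have h3 := ((hasDerivAt_id' x).sub_const y).cpow_const_eq_mul_self hxy (-(b + b')/3)
    refine ((((h1.mul_const _).fun_mul h2).mul_const _).fun_mul h3).congr_deriv ?_
    dsimp only
    ring
  · rintro ⟨x, y⟩ hp
    obtain ⟨hx, hy, hx₁, hy₁, hxy⟩ := hslit _ hp
    have h1 := (hasDerivAt_id' y).cpow_const_eq_mul_self hy (-(c - b)/3)
    have h2 := ((hasDerivAt_id' y).sub_const 1).cpow_const_eq_mul_self hy₁ (-(a + b' - c + 1)/3)
    have h3 := ((hasDerivAt_id' y).const_sub x).cpow_const_eq_mul_self hxy (-(b + b')/3)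
    refine ((((h1.const_mul _).mul_const _).fun_mul h2).fun_mul h3).congr_deriv ?_
    simp only [← neg_sub x y, div_neg]
    ring
  · rintro ⟨x, y⟩ hp
    obtain ⟨hx, hy, hx₁, hy₁, hxy⟩ := hslit _ hp
    exact hasDerivAt_fractions_sub_const _ _ _ (Complex.slitPlane_ne_zero hx)
      (Complex.slitPlane_ne_zero hx₁) (Complex.slitPlane_ne_zero hxy)
  · rintro ⟨x, y⟩ hp
    exact hasDerivAt_fractions_const_sub _ _
      (sub_ne_zero.2 (sub_ne_zero.1 (Complex.slitPlane_ne_zero (hslit _ hp).2.2.2.2)).symm)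
  · rintro ⟨x, y⟩ hp
    obtain ⟨hx, hy, hx₁, hy₁, hxy⟩ := hslit _ hp
    exact hasDerivAt_fractions_sub_const _ _ _ (Complex.slitPlane_ne_zero hy)
      (Complex.slitPlane_ne_zero hy₁)
      (sub_ne_zero.2 (sub_ne_zero.1 (Complex.slitPlane_ne_zero hxy)).symm)
end
end

section
/- For all z₁, z₂, z₃ ∈ ℂ, the Hessian invariants satisfy the two syzygies: 432·C₉² = C₆³ − 3·C₆·C₁₂ + 2·C₁₈ and 1728·𝔠₁₂³ = C₁₈² − C₁₂³. -/
theorem hessian_syzygies (z₁ z₂ z₃ : ℂ)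
    (C₆ C₉ C₁₂ 𝔠₁₂ C₁₈ : ℂ)
    (hC₆ : C₆ = z₁^6 + z₂^6 + z₃^6 - 10*(z₁^3*z₂^3 + z₂^3*z₃^3 + z₃^3*z₁^3))
    (hC₉ : C₉ = (z₁^3 - z₂^3)*(z₂^3 - z₃^3)*(z₃^3 - z₁^3))
    (hC₁₂ : C₁₂ = (z₁^3 + z₂^3 + z₃^3)*((z₁^3 + z₂^3 + z₃^3)^3 + 216*z₁^3*z₂^3*z₃^3))
    (h𝔠₁₂ : 𝔠₁₂ = z₁*z₂*z₃*(27*z₁^3*z₂^3*z₃^3 - (z₁^3 + z₂^3 + z₃^3)^3))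
    (hC₁₈ : C₁₈ = (z₁^3 + z₂^3 + z₃^3)^6 - 540*z₁^3*z₂^3*z₃^3*(z₁^3 + z₂^3 + z₃^3)^3
      - 5832*z₁^6*z₂^6*z₃^6) :
    432*C₉^2 = C₆^3 - 3*C₆*C₁₂ + 2*C₁₈ ∧ 1728*𝔠₁₂^3 = C₁₈^2 - C₁₂^3 := by
  subst hC₆ hC₉ hC₁₂ h𝔠₁₂ hC₁₈
  constructor <;> ring
end

section
/- For all ξ, η ∈ ℂ, the determinant of the 3×3 matrix with rows (∂C₆/∂ξ, ∂C₆/∂η, 2·C₆), (∂C₉/∂ξ, ∂C₉/∂η, 3·C₉), (∂C₁₂/∂ξ, ∂C₁₂/∂η, 4·C₁₂) equals −864·𝔠₁₂². -/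
noncomputable section

/-- Affine Hessian invariant C₆. -/
def C₆ : ℂ → ℂ → ℂ := fun ξ η => ξ^6 + η^6 + 1 - 10*(ξ^3*η^3 + ξ^3 + η^3)
/-- Affine Hessian invariant C₉. -/
def C₉ : ℂ → ℂ → ℂ := fun ξ η => (ξ^3 - η^3)*(η^3 - 1)*(1 - ξ^3)
/-- Affine Hessian invariant C₁₂. -/
def C₁₂ : ℂ → ℂ → ℂ := fun ξ η => (ξ^3 + η^3 + 1)*((ξ^3 + η^3 + 1)^3 + 216*ξ^3*η^3)
/-- Affine Hessian invariant 𝔠₁₂. -/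
def 𝔠₁₂ : ℂ → ℂ → ℂ := fun ξ η => ξ*η*(27*ξ^3*η^3 - (ξ^3 + η^3 + 1)^3)
/-- Affine Hessian invariant C₁₈. -/
def C₁₈ : ℂ → ℂ → ℂ := fun ξ η => (ξ^3 + η^3 + 1)^6 - 540*ξ^3*η^3*(ξ^3 + η^3 + 1)^3 - 5832*ξ^6*η^6

/-- Complex partial derivative in the first variable. -/
def pdξ (f : ℂ → ℂ → ℂ) (ξ η : ℂ) : ℂ := deriv (fun t => f t η) ξ
/-- Complex partial derivative in the second variable. -/
def pdη (f : ℂ → ℂ → ℂ) (ξ η : ℂ) : ℂ := deriv (fun t => f ξ t) η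

theorem pdξ_eq_of_hasDerivAt {f : ℂ → ℂ → ℂ} {ξ η f' : ℂ}
    (h : HasDerivAt (fun t => f t η) f' ξ) : pdξ f ξ η = f' :=
  h.deriv

theorem hasDerivAt_C₆ (ξ η : ℂ) :
    HasDerivAt (fun t => C₆ t η) (6 * ξ^5 - 30 * ξ^2 * (η^3 + 1)) ξ := by
  have h3 := hasDerivAt_pow 3 ξ
  have h := (((hasDerivAt_pow 6 ξ).add_const (η^6)).add_const 1).sub
    ((((h3.mul_const (η^3)).add h3).add_const (η^3)).const_mul 10)
  refine h.congr_deriv ?_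
  norm_num
  ring

theorem hasDerivAt_C₉ (ξ η : ℂ) :
    HasDerivAt (fun t => C₉ t η) (3 * ξ^2 * (η^3 - 1) * (1 + η^3 - 2 * ξ^3)) ξ := by
  have h3 := hasDerivAt_pow 3 ξ
  have h := ((h3.sub_const (η^3)).mul_const (η^3 - 1)).mul (h3.const_sub 1)
  refine h.congr_deriv ?_
  norm_num
  ring

theorem hasDerivAt_C₁₂ (ξ η : ℂ) :
    HasDerivAt (fun t => C₁₂ t η)
      (12 * ξ^2 * (ξ^3 + η^3 + 1)^3 + 648 * ξ^2 * η^3 * (2 * ξ^3 + η^3 + 1)) ξ := by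
  have h3 := hasDerivAt_pow 3 ξ
  have hs := (h3.add_const (η^3)).add_const 1
  have h := hs.mul ((hs.pow 3).add ((h3.const_mul 216).mul_const (η^3)))
  refine h.congr_deriv ?_
  norm_num
  ring

theorem C₆_swap (ξ η : ℂ) : C₆ ξ η = C₆ η ξ := by
  simp only [C₆]
  ring

theorem C₉_swap (ξ η : ℂ) : C₉ ξ η = -C₉ η ξ := by
  simp only [C₉]
  ring

theorem C₁₂_swap (ξ η : ℂ) : C₁₂ ξ η = C₁₂ η ξ := by
  simp only [C₁₂]
  ring

theorem det_C6_C9_C12 (ξ η : ℂ) :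
    Matrix.det !![pdξ C₆ ξ η, pdη C₆ ξ η, 2 * C₆ ξ η;
                  pdξ C₉ ξ η, pdη C₉ ξ η, 3 * C₉ ξ η;
                  pdξ C₁₂ ξ η, pdη C₁₂ ξ η, 4 * C₁₂ ξ η] = -864 * (𝔠₁₂ ξ η)^2 := by
  have hη₆ : pdη C₆ ξ η = pdξ C₆ η ξ := by
    simp only [pdη, pdξ, C₆_swap ξ]
  have hη₉ : pdη C₉ ξ η = -pdξ C₉ η ξ := by
    simp only [pdη, pdξ, C₉_swap ξ, deriv.fun_neg]
  have hη₁₂ : pdη C₁₂ ξ η = pdξ C₁₂ η ξ := by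
    simp only [pdη, pdξ, C₁₂_swap ξ]
  simp only [hη₆, hη₉, hη₁₂, pdξ_eq_of_hasDerivAt (hasDerivAt_C₆ _ _),
    pdξ_eq_of_hasDerivAt (hasDerivAt_C₉ _ _), pdξ_eq_of_hasDerivAt (hasDerivAt_C₁₂ _ _)]
  simp only [Matrix.det_fin_three, Matrix.of_apply, Matrix.cons_val, C₆, C₉, C₁₂, 𝔠₁₂]
  ring
end
end

section
/- For all ξ, η ∈ ℂ, the determinant of the 3×3 matrix with rows (∂C₁₂/∂ξ, ∂C₁₂/∂η, 4·C₁₂), (∂C₁₈/∂ξ, ∂C₁₈/∂η, 6·C₁₈), (∂𝔠₁₂/∂ξ, ∂𝔠₁₂/∂η, 4·𝔠₁₂) equals 0. -/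
noncomputable section

/-- A `3 × 3` matrix whose rows all lie in the span of two fixed vectors is singular. -/
theorem det_eq_zero_of_rows_in_span_pair {R : Type*} [CommRing R]
    (a₁ b₁ a₂ b₂ a₃ b₃ u₁ v₁ u₂ v₂ u₃ v₃ : R) :
    Matrix.det !![a₁ * u₁ + b₁ * v₁, a₁ * u₂ + b₁ * v₂, a₁ * u₃ + b₁ * v₃;
                  a₂ * u₁ + b₂ * v₁, a₂ * u₂ + b₂ * v₂, a₂ * u₃ + b₂ * v₃;
                  a₃ * u₁ + b₃ * v₁, a₃ * u₂ + b₃ * v₂, a₃ * u₃ + b₃ * v₃] = 0 := by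
  rw [Matrix.det_fin_three]
  simp only [Matrix.of_apply, Matrix.cons_val]
  ring

section Curve

variable {s p : ℂ → ℂ} {s' p' t : ℂ}

theorem hasDerivAt_C₁₂_comp (hs : HasDerivAt s s' t) (hp : HasDerivAt p p' t) :
    HasDerivAt (fun x => s x * (s x ^ 3 + 216 * p x ^ 3))
      ((4 * s t ^ 3 + 216 * p t ^ 3) * s' + 648 * s t * p t ^ 2 * p') t := by
  refine (hs.mul ((hs.fun_pow 3).add ((hp.fun_pow 3).const_mul 216))).congr_deriv ?_
  simp only [Pi.add_apply]
  push_cast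
  ring

theorem hasDerivAt_𝔠₁₂_comp (hs : HasDerivAt s s' t) (hp : HasDerivAt p p' t) :
    HasDerivAt (fun x => p x * (27 * p x ^ 3 - s x ^ 3))
      (-3 * p t * s t ^ 2 * s' + (108 * p t ^ 3 - s t ^ 3) * p') t := by
  refine (hp.mul (((hp.fun_pow 3).const_mul 27).sub (hs.fun_pow 3))).congr_deriv ?_
  simp only [Pi.sub_apply]
  push_cast
  ring

theorem hasDerivAt_C₁₈_comp (hs : HasDerivAt s s' t) (hp : HasDerivAt p p' t) :
    HasDerivAt (fun x => s x ^ 6 - 540 * (p x ^ 3 * s x ^ 3) - 5832 * p x ^ 6)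
      ((6 * s t ^ 5 - 1620 * p t ^ 3 * s t ^ 2) * s' +
        (-1620 * p t ^ 2 * s t ^ 3 - 34992 * p t ^ 5) * p') t := by
  refine (((hs.fun_pow 6).sub (((hp.fun_pow 3).mul (hs.fun_pow 3)).const_mul 540)).sub
    ((hp.fun_pow 6).const_mul 5832)).congr_deriv ?_
  push_cast
  ring

end Curve

theorem det_C12_C18_fC12 (ξ η : ℂ) :
    Matrix.det !![pdξ C₁₂ ξ η, pdη C₁₂ ξ η, 4 * C₁₂ ξ η;
                  pdξ C₁₈ ξ η, pdη C₁₈ ξ η, 6 * C₁₈ ξ η;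
                  pdξ 𝔠₁₂ ξ η, pdη 𝔠₁₂ ξ η, 4 * 𝔠₁₂ ξ η] = 0 := by
  have hs₁ : HasDerivAt (fun t : ℂ => t ^ 3 + η ^ 3 + 1) (3 * ξ ^ 2) ξ := by
    simpa using ((hasDerivAt_pow 3 ξ).add_const (η ^ 3)).add_const 1
  have hs₂ : HasDerivAt (fun t : ℂ => ξ ^ 3 + t ^ 3 + 1) (3 * η ^ 2) η := by
    simpa using ((hasDerivAt_pow 3 η).const_add (ξ ^ 3)).add_const 1
  have hp₁ : HasDerivAt (fun t : ℂ => t * η) η ξ := hasDerivAt_mul_const η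
  have hp₂ : HasDerivAt (fun t : ℂ => ξ * t) ξ η := by
    simpa using (hasDerivAt_id η).const_mul ξ
  have ha₁ : pdξ C₁₂ ξ η = _ :=
    ((hasDerivAt_C₁₂_comp hs₁ hp₁).congr_of_eventuallyEq
      (.of_forall fun t => by simp only [C₁₂]; ring)).deriv
  have ha₂ : pdη C₁₂ ξ η = _ :=
    ((hasDerivAt_C₁₂_comp hs₂ hp₂).congr_of_eventuallyEq
      (.of_forall fun t => by simp only [C₁₂]; ring)).deriv
  have hb₁ : pdξ C₁₈ ξ η = _ :=
    ((hasDerivAt_C₁₈_comp hs₁ hp₁).congr_of_eventuallyEq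
      (.of_forall fun t => by simp only [C₁₈]; ring)).deriv
  have hb₂ : pdη C₁₈ ξ η = _ :=
    ((hasDerivAt_C₁₈_comp hs₂ hp₂).congr_of_eventuallyEq
      (.of_forall fun t => by simp only [C₁₈]; ring)).deriv
  have hc₁ : pdξ 𝔠₁₂ ξ η = _ :=
    ((hasDerivAt_𝔠₁₂_comp hs₁ hp₁).congr_of_eventuallyEq
      (.of_forall fun t => by simp only [𝔠₁₂]; ring)).deriv
  have hc₂ : pdη 𝔠₁₂ ξ η = _ :=
    ((hasDerivAt_𝔠₁₂_comp hs₂ hp₂).congr_of_eventuallyEq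
      (.of_forall fun t => by simp only [𝔠₁₂]; ring)).deriv
  have ha₃ : 4 * C₁₂ ξ η = (4 * (ξ ^ 3 + η ^ 3 + 1) ^ 3 + 216 * (ξ * η) ^ 3) *
      (ξ ^ 3 + η ^ 3 + 1) + 648 * (ξ ^ 3 + η ^ 3 + 1) * (ξ * η) ^ 2 * (ξ * η) := by
    simp only [C₁₂]; ring
  have hb₃ : 6 * C₁₈ ξ η = (6 * (ξ ^ 3 + η ^ 3 + 1) ^ 5 -
        1620 * (ξ * η) ^ 3 * (ξ ^ 3 + η ^ 3 + 1) ^ 2) * (ξ ^ 3 + η ^ 3 + 1) +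
      (-1620 * (ξ * η) ^ 2 * (ξ ^ 3 + η ^ 3 + 1) ^ 3 - 34992 * (ξ * η) ^ 5) * (ξ * η) := by
    simp only [C₁₈]; ring
  have hc₃ : 4 * 𝔠₁₂ ξ η = -3 * (ξ * η) * (ξ ^ 3 + η ^ 3 + 1) ^ 2 * (ξ ^ 3 + η ^ 3 + 1) +
      (108 * (ξ * η) ^ 3 - (ξ ^ 3 + η ^ 3 + 1) ^ 3) * (ξ * η) := by
    simp only [𝔠₁₂]; ring
  rw [ha₁, ha₂, ha₃, hb₁, hb₂, hb₃, hc₁, hc₂, hc₃]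
  exact det_eq_zero_of_rows_in_span_pair ..
end
end

section
/- For all z₁, z₂, z₃ ∈ ℂ, with G = (z₁−z₂)(z₂−z₃)(z₃−z₁), H = (z₁³+z₂³+z₃³) + 6·z₁z₂z₃ and K = (z₁³+z₂³+z₃³) − 3·z₁z₂z₃, the following algebraic resolvent identities hold: 4·G³ + H²·G − C₆·G − 4·C₉ = 0; H·(H³ + 8·K³) = 9·C₁₂; K·(K³ − H³) = 27·𝔠₁₂. -/
theorem algebraic_resolvents (z₁ z₂ z₃ : ℂ)
    (G H K C₆ C₉ C₁₂ 𝔠₁₂ : ℂ)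
    (hG : G = (z₁ - z₂)*(z₂ - z₃)*(z₃ - z₁))
    (hH : H = (z₁^3 + z₂^3 + z₃^3) + 6*(z₁*z₂*z₃))
    (hK : K = (z₁^3 + z₂^3 + z₃^3) - 3*(z₁*z₂*z₃))
    (hC₆ : C₆ = z₁^6 + z₂^6 + z₃^6 - 10*(z₁^3*z₂^3 + z₂^3*z₃^3 + z₃^3*z₁^3))
    (hC₉ : C₉ = (z₁^3 - z₂^3)*(z₂^3 - z₃^3)*(z₃^3 - z₁^3))
    (hC₁₂ : C₁₂ = (z₁^3 + z₂^3 + z₃^3)*((z₁^3 + z₂^3 + z₃^3)^3 + 216*z₁^3*z₂^3*z₃^3))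
    (h𝔠₁₂ : 𝔠₁₂ = z₁*z₂*z₃*(27*z₁^3*z₂^3*z₃^3 - (z₁^3 + z₂^3 + z₃^3)^3)) :
    4*G^3 + H^2*G - C₆*G - 4*C₉ = 0 ∧ H*(H^3 + 8*K^3) = 9*C₁₂ ∧ K*(K^3 - H^3) = 27*𝔠₁₂ := by
  subst hG hH hK hC₆ hC₉ hC₁₂ h𝔠₁₂
  refine ⟨?_, ?_, ?_⟩ <;> ring
end

section
/- Let z₁, z₂, z₃ ∈ ℂ with C₆ ≠ 0. Set G = (z₁−z₂)(z₂−z₃)(z₃−z₁), H = (z₁³+z₂³+z₃³) + 6·z₁z₂z₃, r₁ = G²/C₆, r₂ = H²/C₆, and Z₁ = 432·C₉²/C₆³. Then Z₁ = 27·r₁·(4·r₁ + r₂ − 1)². -/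
theorem Z₁_resolvent (z₁ z₂ z₃ : ℂ)
    (C₆ C₉ G H r₁ r₂ Z₁ : ℂ)
    (hC₆ : C₆ = z₁^6 + z₂^6 + z₃^6 - 10*(z₁^3*z₂^3 + z₂^3*z₃^3 + z₃^3*z₁^3))
    (hC₆ne : C₆ ≠ 0)
    (hC₉ : C₉ = (z₁^3 - z₂^3)*(z₂^3 - z₃^3)*(z₃^3 - z₁^3))
    (hG : G = (z₁ - z₂)*(z₂ - z₃)*(z₃ - z₁))
    (hH : H = (z₁^3 + z₂^3 + z₃^3) + 6*(z₁*z₂*z₃))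
    (hr₁ : r₁ = G^2 / C₆)
    (hr₂ : r₂ = H^2 / C₆)
    (hZ₁ : Z₁ = 432 * C₉^2 / C₆^3) :
    Z₁ = 27 * r₁ * (4*r₁ + r₂ - 1)^2 := by
  have key : 4*G^2 + H^2 - C₆ =
      4 * ((z₁^2 + z₁*z₂ + z₂^2) * (z₂^2 + z₂*z₃ + z₃^2) * (z₃^2 + z₃*z₁ + z₁^2)) := by
    rw [hG, hH, hC₆]
    ring
  have hC₉G : C₉ =
      G * ((z₁^2 + z₁*z₂ + z₂^2) * (z₂^2 + z₂*z₃ + z₃^2) * (z₃^2 + z₃*z₁ + z₁^2)) := by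
    rw [hC₉, hG]
    ring
  have hsum : 4*r₁ + r₂ - 1 = (4*G^2 + H^2 - C₆) / C₆ := by
    rw [hr₁, hr₂]
    field_simp
  rw [hsum, key, hZ₁, hC₉G, hr₁]
  ring
end

section
/- Let z₁, z₂, z₃ ∈ ℂ be such that C₆, C₉, C₁₂ and 𝔠₁₂ are all nonzero. Set G = (z₁−z₂)(z₂−z₃)(z₃−z₁), H = (z₁³+z₂³+z₃³) + 6·z₁z₂z₃, K = (z₁³+z₂³+z₃³) − 3·z₁z₂z₃, Z₁ = 432·C₉²/C₆³, Z₂ = 3·C₁₂/C₆², u = C₆·G/C₉, v = C₉·H/C₁₂, w = C₉·K/𝔠₁₂. Then: Z₁²·u³ + 5184·Z₂²·u·v² − 108·Z₁·u − 432·Z₁ = 0; 6912·Z₂³·v⁴ + 8·(27·(Z₁+Z₂−1)² − 4·Z₂³)·v·w³ − 9·Z₁² = 0; (27·(Z₁+Z₂−1)² − 4·Z₂³)·w⁴ − 6912·Z₂³·v³·w − 27·Z₁² = 0. -/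
/-- The degree-18 relation `432 C₉² = C₆³ - 3 C₆ C₁₂ + 2 C₁₈` among the Hessian invariants, with `C₁₈`
written in terms of `z₁³ + z₂³ + z₃³` and `z₁z₂z₃`. -/
lemma hessian_C₁₈_relation (a b c s q : ℂ) (hs : s = a + b + c) (hq : q = a*b*c) :
    432*((a - b)*(b - c)*(c - a))^2
      + 3*(s*(s^3 + 216*q))*(a^2 + b^2 + c^2 - 10*(a*b + b*c + c*a))
      - (a^2 + b^2 + c^2 - 10*(a*b + b*c + c*a))^3
      = 2*(s^6 - 540*s^3*q - 5832*q^2) := by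
  subst hs hq
  ring

theorem uvw_resolvents (z₁ z₂ z₃ : ℂ)
    (C₆ C₉ C₁₂ 𝔠₁₂ G H K Z₁ Z₂ u v w : ℂ)
    (hC₆ : C₆ = z₁^6 + z₂^6 + z₃^6 - 10*(z₁^3*z₂^3 + z₂^3*z₃^3 + z₃^3*z₁^3))
    (hC₉ : C₉ = (z₁^3 - z₂^3)*(z₂^3 - z₃^3)*(z₃^3 - z₁^3))
    (hC₁₂ : C₁₂ = (z₁^3 + z₂^3 + z₃^3)*((z₁^3 + z₂^3 + z₃^3)^3 + 216*z₁^3*z₂^3*z₃^3))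
    (h𝔠₁₂ : 𝔠₁₂ = z₁*z₂*z₃*(27*z₁^3*z₂^3*z₃^3 - (z₁^3 + z₂^3 + z₃^3)^3))
    (hC₆ne : C₆ ≠ 0) (hC₉ne : C₉ ≠ 0) (hC₁₂ne : C₁₂ ≠ 0) (h𝔠₁₂ne : 𝔠₁₂ ≠ 0)
    (hG : G = (z₁ - z₂)*(z₂ - z₃)*(z₃ - z₁))
    (hH : H = (z₁^3 + z₂^3 + z₃^3) + 6*(z₁*z₂*z₃))
    (hK : K = (z₁^3 + z₂^3 + z₃^3) - 3*(z₁*z₂*z₃))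
    (hZ₁ : Z₁ = 432 * C₉^2 / C₆^3)
    (hZ₂ : Z₂ = 3 * C₁₂ / C₆^2)
    (hu : u = C₆ * G / C₉)
    (hv : v = C₉ * H / C₁₂)
    (hw : w = C₉ * K / 𝔠₁₂) :
    Z₁^2*u^3 + 5184*Z₂^2*u*v^2 - 108*Z₁*u - 432*Z₁ = 0 ∧
    6912*Z₂^3*v^4 + 8*(27*(Z₁ + Z₂ - 1)^2 - 4*Z₂^3)*v*w^3 - 9*Z₁^2 = 0 ∧
    (27*(Z₁ + Z₂ - 1)^2 - 4*Z₂^3)*w^4 - 6912*Z₂^3*v^3*w - 27*Z₁^2 = 0 := by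
  have hD : (432*C₉^2 + 3*C₁₂*C₆ - C₆^3)^2 - 4*C₁₂^3 = 6912*𝔠₁₂^3 := by
    have h := hessian_C₁₈_relation (z₁^3) (z₂^3) (z₃^3) _ _ rfl rfl
    have h18 : 432*C₉^2 + 3*C₁₂*C₆ - C₆^3 =
        2*((z₁^3 + z₂^3 + z₃^3)^6 - 540*(z₁^3 + z₂^3 + z₃^3)^3*(z₁^3*z₂^3*z₃^3)
          - 5832*(z₁^3*z₂^3*z₃^3)^2) := by
      rw [← h, hC₆, hC₉, hC₁₂]
      ring
    rw [h18, hC₁₂, h𝔠₁₂]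
    generalize z₁^3 + z₂^3 + z₃^3 = s
    ring
  have hZ : 27*(Z₁ + Z₂ - 1)^2 - 4*Z₂^3 = 27*6912*𝔠₁₂^3 / C₆^6 := by
    rw [hZ₁, hZ₂]
    field_simp
    linear_combination 27*hD
  have hGH : 4*G^3 + G*H^2 - C₆*G - 4*C₉ = 0 := by
    rw [hG, hH, hC₆, hC₉]
    ring
  have hHK : H*(H^3 + 8*K^3) = 9*C₁₂ := by
    rw [hH, hK, hC₁₂]
    generalize z₁^3 + z₂^3 + z₃^3 = s
    ring
  have hKH : K*(K^3 - H^3) = 27*𝔠₁₂ := by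
    rw [hH, hK, h𝔠₁₂]
    generalize z₁^3 + z₂^3 + z₃^3 = s
    ring
  clear hC₆ hC₉ hC₁₂ h𝔠₁₂ hG hH hK hD
  refine ⟨?_, ?_, ?_⟩
  · have : Z₁^2*u^3 + 5184*Z₂^2*u*v^2 - 108*Z₁*u - 432*Z₁
        = 46656*C₉/C₆^3 * (4*G^3 + G*H^2 - C₆*G - 4*C₉) := by
      rw [hZ₁, hZ₂, hu, hv]
      field_simp
      ring
    rw [this, hGH, mul_zero]
  · have : 6912*Z₂^3*v^4 + 8*(27*6912*𝔠₁₂^3 / C₆^6)*v*w^3 - 9*Z₁^2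
        = 186624*C₉^4/(C₆^6*C₁₂) * (H*(H^3 + 8*K^3) - 9*C₁₂) := by
      rw [hZ₁, hZ₂, hv, hw]
      field_simp
      ring
    rw [hZ, this, hHK, sub_self, mul_zero]
  · have : (27*6912*𝔠₁₂^3 / C₆^6)*w^4 - 6912*Z₂^3*v^3*w - 27*Z₁^2
        = 186624*C₉^4/(C₆^6*𝔠₁₂) * (K*(K^3 - H^3) - 27*𝔠₁₂) := by
      rw [hZ₁, hZ₂, hv, hw]
      field_simp
      ring
    rw [hZ, this, hKH, sub_self, mul_zero]
end

section
/- Let z₁, z₂, z₃ ∈ ℂ be such that C₆ ≠ 0 and C₉ ≠ 0. Set H = (z₁³+z₂³+z₃³) + 6·z₁z₂z₃, K = (z₁³+z₂³+z₃³) − 3·z₁z₂z₃, Z₁ = 432·C₉²/C₆³, Z₂ = 3·C₁₂/C₆², ζ₁ = K³/C₉ and ζ₂ = H³/C₉. Then Z₁²·ζ₂·(ζ₂ + 8·ζ₁)³ = 2⁸·3⁹·Z₂³ and Z₁²·ζ₁·(ζ₁ − ζ₂)³ = 27³·(27·(Z₁+Z₂−1)² − 4·Z₂³). -/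
/-- The syzygy `432 C₉² + 3 C₁₂ C₆ - C₆³ = 2 C₁₈` between the Hessian invariants, in terms of the
cubes `a`, `b`, `c` of the coordinates. -/
theorem hessian_syzygy {R : Type*} [CommRing R] (a b c : R) :
    432 * ((a - b) * (b - c) * (c - a))^2
      + 3 * ((a + b + c) * ((a + b + c)^3 + 216 * (a * b * c)))
        * (a^2 + b^2 + c^2 - 10 * (a * b + b * c + c * a))
      - (a^2 + b^2 + c^2 - 10 * (a * b + b * c + c * a))^3
    = 2 * ((a + b + c)^6 - 540 * (a + b + c)^3 * (a * b * c) - 5832 * (a * b * c)^2) := by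
  ring

theorem zeta_resolvents (z₁ z₂ z₃ : ℂ)
    (C₆ C₉ C₁₂ H K Z₁ Z₂ ζ₁ ζ₂ : ℂ)
    (hC₆ : C₆ = z₁^6 + z₂^6 + z₃^6 - 10*(z₁^3*z₂^3 + z₂^3*z₃^3 + z₃^3*z₁^3))
    (hC₉ : C₉ = (z₁^3 - z₂^3)*(z₂^3 - z₃^3)*(z₃^3 - z₁^3))
    (hC₁₂ : C₁₂ = (z₁^3 + z₂^3 + z₃^3)*((z₁^3 + z₂^3 + z₃^3)^3 + 216*z₁^3*z₂^3*z₃^3))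
    (hC₆ne : C₆ ≠ 0) (hC₉ne : C₉ ≠ 0)
    (hH : H = (z₁^3 + z₂^3 + z₃^3) + 6*(z₁*z₂*z₃))
    (hK : K = (z₁^3 + z₂^3 + z₃^3) - 3*(z₁*z₂*z₃))
    (hZ₁ : Z₁ = 432 * C₉^2 / C₆^3)
    (hZ₂ : Z₂ = 3 * C₁₂ / C₆^2)
    (hζ₁ : ζ₁ = K^3 / C₉)
    (hζ₂ : ζ₂ = H^3 / C₉) :
    Z₁^2 * ζ₂ * (ζ₂ + 8*ζ₁)^3 = 2^8 * 3^9 * Z₂^3 ∧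
    Z₁^2 * ζ₁ * (ζ₁ - ζ₂)^3 = 27^3 * (27*(Z₁ + Z₂ - 1)^2 - 4*Z₂^3) := by
  set s := z₁^3 + z₂^3 + z₃^3 with hs
  set p := z₁ * z₂ * z₃ with hp
  have hC₁₂' : C₁₂ = s * (s^3 + 216 * p^3) := by rw [hC₁₂, hp]; ring
  have syzygy : 432 * C₉^2 + 3 * C₁₂ * C₆ - C₆^3 = 2 * (s^6 - 540 * s^3 * p^3 - 5832 * p^6) := by
    have h := hessian_syzygy (z₁^3) (z₂^3) (z₃^3)
    rw [← hs, show z₁^3 * z₂^3 * z₃^3 = p^3 by rw [hp]; ring, ← hC₁₂', ← hC₉,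
      show (z₁^3)^2 + (z₂^3)^2 + (z₃^3)^2 - 10 * (z₁^3 * z₂^3 + z₂^3 * z₃^3 + z₃^3 * z₁^3) = C₆ by
        rw [hC₆]; ring] at h
    rw [h]; ring
  have sum_factor : H^3 * (H^3 + 8 * K^3)^3 = 3^6 * C₁₂^3 := by
    rw [hC₁₂', hH, hK]; ring
  have diff_factor : 432^2 * (K^3 * (K^3 - H^3)^3)
      = 27^3 * (27 * (432 * C₉^2 + 3 * C₁₂ * C₆ - C₆^3)^2 - 108 * C₁₂^3) := by
    rw [syzygy, hC₁₂', hH, hK]; ring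
  have hZ : Z₁ + Z₂ - 1 = (432 * C₉^2 + 3 * C₁₂ * C₆ - C₆^3) / C₆^3 := by
    rw [hZ₁, hZ₂]; field_simp
  constructor
  · calc Z₁^2 * ζ₂ * (ζ₂ + 8 * ζ₁)^3
        = 432^2 * (H^3 * (H^3 + 8 * K^3)^3) / C₆^6 := by
          rw [hZ₁, hζ₁, hζ₂]; field_simp
      _ = 2^8 * 3^9 * Z₂^3 := by
          rw [sum_factor, hZ₂]; field_simp; ring
  · calc Z₁^2 * ζ₁ * (ζ₁ - ζ₂)^3
        = 432^2 * (K^3 * (K^3 - H^3)^3) / C₆^6 := by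
          rw [hZ₁, hζ₁, hζ₂]; field_simp
      _ = 27^3 * (27 * (Z₁ + Z₂ - 1)^2 - 4 * Z₂^3) := by
          rw [diff_factor, hZ, hZ₂]; field_simp; ring
end
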